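/- arXiv:2008.01056 — 7 statements merged into one kernel-verified Lean document; each statement's English description precedes it below -/
import Mathlib

section
/- For every tree T of order n with n ≥ 2, we have 6·(bdim(T))² ≥ n; equivalently, bdim(T) ≥ √(n/6). -/
open SimpleGraph

/-- `f` is a resolving broadcast of `G`: for any two distinct vertices `x, y` there is a
vertex `z` with `f z > 0` such that `min (d(x,z)) (f z + 1) ≠ min (d(y,z)) (f z + 1)`,
where distances are extended naturals (`⊤` for vertices in different components). -/
def IsResolvingBroadcast {V : Type*} (G : SimpleGraph V) (f : V → ℕ) : Prop :=
  ∀ x y : V, x ≠ y → ∃ z : V, 0 < f z ∧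
    min (G.edist x z) ((f z : ℕ∞) + 1) ≠ min (G.edist y z) ((f z : ℕ∞) + 1)

/-- The broadcast dimension of `G`: the minimum of `∑ v, f v` over all
resolving broadcasts `f` of `G`. -/
noncomputable def bdim {V : Type*} [Fintype V] (G : SimpleGraph V) : ℕ :=
  sInf {n : ℕ | ∃ f : V → ℕ, IsResolvingBroadcast G f ∧ ∑ v, f v = n}

namespace SimpleGraph

variable {V : Type*} {G : SimpleGraph V}

/-- In a tree, if `i` lies on the far side of the edge `pq` from `p`, and `j` on the far side
from `q`, then `p` lies between `i` and `j`. -/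
lemma IsTree.dist_eq_add_of_adj (hG : G.IsTree) {i j p q : V} (hpq : G.Adj p q)
    (hi : G.dist p i = G.dist q i + 1) (hj : G.dist q j = G.dist p j + 1) :
    G.dist i j = G.dist i p + G.dist p j := by
  classical
  obtain ⟨w, hw, hwl⟩ := hG.connected.exists_path_of_dist i q
  obtain ⟨u, hu, hul⟩ := hG.connected.exists_path_of_dist p j
  obtain ⟨t, ht, htl⟩ := hG.connected.exists_path_of_dist i j
  have hdisj : ∀ v, v ∈ w.support → v ∉ u.support := by
    intro v hvw hvu
    have h₁ := congrArg Walk.length (w.take_spec hvw)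
    have h₂ := congrArg Walk.length (u.take_spec hvu)
    rw [Walk.length_append] at h₁ h₂
    have := dist_le (w.takeUntil v hvw)
    have := dist_le (w.dropUntil v hvw)
    have := dist_le (u.takeUntil v hvu)
    have := dist_le (u.dropUntil v hvu)
    have := hG.connected.dist_triangle (u := p) (v := v) (w := i)
    have := hG.connected.dist_triangle (u := q) (v := v) (w := j)
    have := G.dist_comm (u := p) (v := v)
    have := G.dist_comm (u := q) (v := v)
    have := G.dist_comm (u := i) (v := v)
    have := G.dist_comm (u := i) (v := q)
    omega
  have hpath : (w.append (Walk.cons hpq.symm u)).IsPath := by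
    rw [Walk.isPath_def, Walk.support_append, Walk.support_cons, List.tail_cons,
      List.nodup_append]
    exact ⟨hw.support_nodup, hu.support_nodup,
      fun a ha b hb hab => hdisj a ha (hab ▸ hb)⟩
  have heq := (hG.existsUnique_path i j).unique ht hpath
  have hlen := congrArg Walk.length heq
  rw [Walk.length_append, Walk.length_cons] at hlen
  have := G.dist_comm (u := i) (v := p)
  have := G.dist_comm (u := i) (v := q)
  omega

/-- In a tree, a vertex between `i` and `j` is determined by its distance to `i`. -/
lemma IsTree.eq_of_dist_eq_add (hG : G.IsTree) {i j p q : V}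
    (hp : G.dist i j = G.dist i p + G.dist p j) (hq : G.dist i j = G.dist i q + G.dist q j)
    (hpq : G.dist i p = G.dist i q) : p = q := by
  have key : ∀ r, G.dist i j = G.dist i r + G.dist r j →
      ∃ w : G.Walk i j, w.IsPath ∧ w.getVert (G.dist i r) = r := by
    intro r hr
    obtain ⟨u, hu⟩ := hG.connected.exists_walk_length_eq_dist i r
    obtain ⟨v, hv⟩ := hG.connected.exists_walk_length_eq_dist r j
    refine ⟨u.append v, Walk.isPath_of_length_eq_dist _ ?_, ?_⟩
    · rw [Walk.length_append]
      omega
    · simp [Walk.getVert_append, hu]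
  obtain ⟨w, hw, hwp⟩ := key p hp
  obtain ⟨w', hw', hwq⟩ := key q hq
  rw [← hwp, ← hwq, (hG.existsUnique_path i j).unique hw hw', hpq]

/-- Projection of a vertex of a finite tree to the convex hull of a nonempty set `S`: the
projection `p` lies between two members of `S`, and on every path from `x` to `S`. -/
lemma IsTree.exists_projection [Finite V] (hG : G.IsTree) (x : V) {S : Set V}
    (hS : S.Nonempty) :
    ∃ i ∈ S, ∃ j ∈ S, ∃ p, G.dist i j = G.dist i p + G.dist p j ∧
      ∀ l ∈ S, G.dist x l = G.dist x p + G.dist p l := by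
  obtain ⟨i, hi⟩ := hS
  obtain ⟨p, hp, hmax⟩ := Set.exists_max_image
    {p | ∀ l ∈ S, G.dist x l = G.dist x p + G.dist p l} (G.dist x) (Set.toFinite _)
    ⟨x, fun l _ => by simp⟩
  by_cases hpi : p = i
  · subst hpi
    exact ⟨p, hi, p, hi, p, by simp, hp⟩
  obtain ⟨q, hpq, hqi⟩ : ∃ q, G.Adj p q ∧ G.dist p i = G.dist q i + 1 := by
    obtain ⟨w, hw⟩ := hG.connected.exists_walk_length_eq_dist p i
    cases w with
    | nil => exact absurd rfl hpi
    | @cons _ q _ h w =>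
      refine ⟨q, h, ?_⟩
      rw [Walk.length_cons] at hw
      have := dist_le w
      have := hG.connected.dist_triangle (u := p) (v := q) (w := i)
      have := dist_eq_one_iff_adj.mpr h
      omega
  have hpq1 := dist_eq_one_iff_adj.mpr hpq
  have hxq : G.dist x q = G.dist x p + 1 := by
    have := hp i hi
    have := hG.connected.dist_triangle (u := x) (v := q) (w := i)
    have := hG.connected.dist_triangle (u := x) (v := p) (w := q)
    omega
  have hq : ¬ ∀ l ∈ S, G.dist x l = G.dist x q + G.dist q l := fun h => by
    have := hmax q h
    omega
  push Not at hq
  obtain ⟨j, hj, hne⟩ := hq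
  refine ⟨i, hi, j, hj, p, hG.dist_eq_add_of_adj hpq hqi ?_, hp⟩
  have := hp j hj
  have := hG.dist_eq_dist_add_one_of_adj j hpq
  rw [G.dist_comm (u := j), G.dist_comm (u := j)] at this
  omega

end SimpleGraph

lemma isResolvingBroadcast_one {V : Type*} (G : SimpleGraph V) :
    IsResolvingBroadcast G fun _ => 1 := by
  intro x y hxy
  refine ⟨x, one_pos, fun h => ?_⟩
  rw [edist_self, zero_min] at h
  have hpos : 0 < min (G.edist y x) (((1 : ℕ) : ℕ∞) + 1) :=
    lt_min (edist_pos_of_ne hxy.symm) (by simp)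
  exact hpos.ne h

lemma exists_isResolvingBroadcast_sum_eq_bdim {V : Type*} [Fintype V] (G : SimpleGraph V) :
    ∃ f : V → ℕ, IsResolvingBroadcast G f ∧ ∑ v, f v = bdim G :=
  Nat.sInf_mem (s := {n : ℕ | ∃ f : V → ℕ, IsResolvingBroadcast G f ∧ ∑ v, f v = n})
    ⟨_, _, isResolvingBroadcast_one G, rfl⟩

lemma IsResolvingBroadcast.eq_of_forall_dist {V : Type*} {G : SimpleGraph V}
    (hG : G.Connected) {f : V → ℕ} (hf : IsResolvingBroadcast G f) {x y : V}
    (h : ∀ z, 0 < f z → G.dist x z ≤ f z ∨ G.dist y z ≤ f z → G.dist x z = G.dist y z) :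
    x = y := by
  by_contra hxy
  obtain ⟨z, hz, hne⟩ := hf x y hxy
  refine hne ?_
  rw [← (hG x z).coe_dist_eq_edist, ← (hG y z).coe_dist_eq_edist]
  by_cases hxyz : G.dist x z ≤ f z ∨ G.dist y z ≤ f z
  · rw [h z hz hxyz]
  · push Not at hxyz
    rw [min_eq_right (mod_cast hxyz.1), min_eq_right (mod_cast hxyz.2)]

/-- A resolving broadcast of cost `b` on a tree distinguishes at most `1 + (2 * b) ^ 2` vertices:
a vertex reached by the broadcast is determined by two sources and its distances to them. -/
lemma IsResolvingBroadcast.card_le {V : Type*} [Fintype V] {T : SimpleGraph V} (hT : T.IsTree)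
    {f : V → ℕ} (hf : IsResolvingBroadcast T f) :
    Fintype.card V ≤ (2 * ∑ v, f v) ^ 2 + 1 := by
  let A := Σ z : V, Fin (2 * f z)
  let Codes (x : V) : Option (A × A) → Prop
    | none => ∀ z, 0 < f z → f z < T.dist x z
    | some (a, b) => T.dist x a.1 = a.2 ∧ T.dist x b.1 = b.2 ∧
        ∃ p, T.dist a.1 b.1 = T.dist a.1 p + T.dist p b.1 ∧
          T.dist x a.1 = T.dist x p + T.dist p a.1 ∧ T.dist x b.1 = T.dist x p + T.dist p b.1 ∧
          ∀ l, 0 < f l → T.dist x l ≤ f l → T.dist x l = T.dist x p + T.dist p l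
  have hex : ∀ x, ∃ c, Codes x c := by
    intro x
    obtain hS | hS := {z | 0 < f z ∧ T.dist x z ≤ f z}.eq_empty_or_nonempty
    · refine ⟨none, fun z hz => ?_⟩
      by_contra! h
      exact Set.notMem_empty z (hS ▸ ⟨hz, h⟩)
    · obtain ⟨i, hi, j, hj, p, hp, hl⟩ := hT.exists_projection x hS
      exact ⟨some (⟨i, T.dist x i, by have := hi.1; have := hi.2; omega⟩,
        ⟨j, T.dist x j, by have := hj.1; have := hj.2; omega⟩),
        rfl, rfl, p, hp, hl i hi, hl j hj, fun l h₁ h₂ => hl l ⟨h₁, h₂⟩⟩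
  choose c hc using hex
  have hinj : Function.Injective c := by
    intro x y hxy
    have hx := hc x
    have hy := hc y
    rw [← hxy] at hy
    refine hf.eq_of_forall_dist hT.connected fun z hz hxyz => ?_
    rcases hcx : c x with _ | ⟨a, b⟩ <;> rw [hcx] at hx hy
    · have := hx z hz
      have := hy z hz
      omega
    · obtain ⟨hxa, hxb, p, hp, hpa, hpb, hpl⟩ := hx
      obtain ⟨hya, hyb, q, hq, hqa, hqb, hql⟩ := hy
      rw [T.dist_comm (u := p) (v := a.1)] at hpa
      rw [T.dist_comm (u := q) (v := a.1)] at hqa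
      obtain rfl := hT.eq_of_dist_eq_add hp hq (by omega)
      have := hpl z hz
      have := hql z hz
      have := hT.connected.dist_triangle (u := x) (v := p) (w := z)
      have := hT.connected.dist_triangle (u := y) (v := p) (w := z)
      omega
  calc Fintype.card V ≤ Fintype.card (Option (A × A)) := Fintype.card_le_of_injective c hinj
    _ = (2 * ∑ v, f v) ^ 2 + 1 := by simp [A, Finset.mul_sum, sq]

/-- For every tree `T` of order `n ≥ 2`, we have `6 * (bdim T)^2 ≥ n`. -/
theorem bdim_tree_sq_lower_bound {V : Type*} [Fintype V] (T : SimpleGraph V)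
    (hT : T.IsTree) (hn : 2 ≤ Fintype.card V) :
    Fintype.card V ≤ 6 * (bdim T) ^ 2 := by
  obtain ⟨f, hf, hsum⟩ := exists_isResolvingBroadcast_sum_eq_bdim T
  have hcard := hf.card_le hT
  rw [hsum] at hcard
  have hpos : 1 ≤ bdim T := by
    by_contra! h
    simp [Nat.lt_one_iff.mp h] at hcard
    omega
  nlinarith
end

section
/- For every forest (acyclic simple graph) G of order n with n ≥ 2, we have 6·(bdim(G))² ≥ n; equivalently, bdim(G) ≥ √(n/6). -/
open SimpleGraph

namespace SimpleGraph

variable {V : Type*} {G : SimpleGraph V}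

lemma Walk.IsPath.append_of_inter {u m w : V} {p : G.Walk u m} {q : G.Walk m w}
    (hp : p.IsPath) (hq : q.IsPath) (h : ∀ x ∈ p.support, x ∈ q.support → x = m) :
    (p.append q).IsPath := by
  have hq' := hq.support_nodup
  rw [← q.cons_tail_support, List.nodup_cons] at hq'
  rw [Walk.isPath_def, Walk.support_append, List.nodup_append']
  refine ⟨hp.support_nodup, hq'.2, fun x hxp hxq => ?_⟩
  have := h x hxp (List.mem_of_mem_tail hxq)
  exact hq'.1 (this ▸ hxq)

lemma IsAcyclic.length_eq_dist_of_isPath (hG : G.IsAcyclic) {u v : V} {p : G.Walk u v}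
    (hp : p.IsPath) : p.length = G.dist u v := by
  obtain ⟨q, hq, hlen⟩ := p.reachable.exists_path_of_dist
  have := congrArg Subtype.val ((hG.subsingleton_path u v).elim ⟨p, hp⟩ ⟨q, hq⟩)
  simp only at this
  rw [this, hlen]

lemma IsAcyclic.dist_add_dist_of_mem_support (hG : G.IsAcyclic) {u v m : V} {p : G.Walk u v}
    (hp : p.IsPath) (hm : m ∈ p.support) : G.dist u m + G.dist m v = G.dist u v := by
  obtain ⟨q, r, hq, hr, rfl⟩ := hp.mem_support_iff_exists_append.1 hm
  rw [← hG.length_eq_dist_of_isPath hp, ← hG.length_eq_dist_of_isPath hq,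
    ← hG.length_eq_dist_of_isPath hr, Walk.length_append]

lemma IsAcyclic.dist_eq_add_or_of_mem_support (hG : G.IsAcyclic) {u v m n : V} {p : G.Walk u v}
    (hp : p.IsPath) (hm : m ∈ p.support) (hn : n ∈ p.support) :
    G.dist u n = G.dist u m + G.dist m n ∨ G.dist u m = G.dist u n + G.dist m n := by
  have hmv := hG.dist_add_dist_of_mem_support hp hm
  have hnv := hG.dist_add_dist_of_mem_support hp hn
  obtain ⟨q, r, hq, hr, rfl⟩ := hp.mem_support_iff_exists_append.1 hm
  rcases Walk.mem_support_append_iff .. |>.1 hn with h | h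
  · have := hG.dist_add_dist_of_mem_support hq h
    rw [G.dist_comm (u := n)] at this
    exact .inr this.symm
  · have := hG.dist_add_dist_of_mem_support hr h
    left
    omega

/-- Every vertex `w` reachable from a path has a gate on that path. -/
lemma IsAcyclic.exists_gate (hG : G.IsAcyclic) {u v w : V} {p : G.Walk u v} (hp : p.IsPath)
    (hw : G.Reachable u w) : ∃ m ∈ p.support,
      G.dist u w = G.dist u m + G.dist m w ∧ G.dist v w = G.dist v m + G.dist m w := by
  classical
  obtain ⟨m, hm, hmin⟩ := p.support.toFinset.exists_min_image (fun x => G.dist x w)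
    ⟨u, by simp⟩
  rw [List.mem_toFinset] at hm
  have key : ∀ {a : V} (q : G.Walk a m), q.IsPath → q.support ⊆ p.support →
      G.dist a w = G.dist a m + G.dist m w := by
    intro a q hq hsub
    have hmw : G.Reachable m w := (p.takeUntil m hm).reachable.symm.trans hw
    obtain ⟨r, hr, hlen⟩ := hmw.exists_path_of_dist
    have hpath : (q.append r).IsPath := by
      refine hq.append_of_inter hr fun x hxq hxr => ?_
      have h₁ := hG.dist_add_dist_of_mem_support hr hxr
      have h₂ := hmin x (by simpa using hsub hxq)
      have hmx : G.Reachable m x := (r.takeUntil x hxr).reachable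
      exact (hmx.dist_eq_zero_iff.1 (by omega)).symm
    rw [← hG.length_eq_dist_of_isPath hpath, ← hG.length_eq_dist_of_isPath hq, ← hlen,
      Walk.length_append]
  refine ⟨m, hm, key _ (hp.takeUntil hm) (p.support_takeUntil_subset_support hm),
    key (p.dropUntil m hm).reverse (hp.dropUntil hm).reverse ?_⟩
  intro x hx
  rw [Walk.support_reverse, List.mem_reverse] at hx
  exact p.support_dropUntil_subset_support hm hx

/-- The four-point condition for the distance of a forest. -/
lemma IsAcyclic.four_point (hG : G.IsAcyclic) {u v w r : V} (hv : G.Reachable u v)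
    (hw : G.Reachable u w) (hr : G.Reachable u r) :
    G.dist u v + G.dist w r ≤
      max (G.dist u w + G.dist v r) (G.dist v w + G.dist u r) := by
  obtain ⟨p, hp, -⟩ := hv.exists_path_of_dist
  obtain ⟨m, hm, hm₁, hm₂⟩ := hG.exists_gate hp hw
  obtain ⟨n, hn, hn₁, hn₂⟩ := hG.exists_gate hp hr
  have hum := hG.dist_add_dist_of_mem_support hp hm
  have hun := hG.dist_add_dist_of_mem_support hp hn
  have hmn := hG.dist_eq_add_or_of_mem_support hp hm hn
  obtain ⟨q, -, -⟩ := Walk.mem_support_iff_exists_append.1 hm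
  obtain ⟨q', -, -⟩ := Walk.mem_support_iff_exists_append.1 hn
  have t₁ : G.dist w r ≤ G.dist w m + G.dist m r :=
    (hw.symm.trans q.reachable).dist_triangle_left r
  have t₂ : G.dist m r ≤ G.dist m n + G.dist n r :=
    (q.reachable.symm.trans q'.reachable).dist_triangle_left r
  rw [G.dist_comm (u := w) (v := m)] at t₁
  rw [G.dist_comm (u := m) (v := v)] at hum
  rw [G.dist_comm (u := n) (v := v)] at hun
  omega

/-- Balls of a forest, restricted to a sphere, form a laminar family. -/
lemma IsAcyclic.laminar_of_edist_eq (hG : G.IsAcyclic) {c p q x y w : V} {d s t : ℕ}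
    (hx : G.edist x c = d) (hy : G.edist y c = d) (hw : G.edist w c = d)
    (hxp : G.edist x p ≤ s) (hxq : G.edist x q ≤ t) (hyp : G.edist y p ≤ s)
    (hwq : G.edist w q ≤ t) : G.edist y q ≤ t ∨ G.edist w p ≤ s := by
  have reach {a b : V} {k : ℕ} (h : G.edist a b ≤ k) : G.Reachable a b :=
    reachable_of_edist_ne_top (ne_top_of_le_ne_top (ENat.natCast_ne_top k) h)
  have rx := reach hx.le
  have ry := reach hy.le
  have rw' := reach hw.le
  have rp := reach hxp
  have rq := reach hxq
  have ryq : G.Reachable y q := ry.trans (rx.symm.trans rq)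
  have rwp : G.Reachable w p := rw'.trans (rx.symm.trans rp)
  rw [← rx.coe_dist_eq_edist] at hx
  rw [← ry.coe_dist_eq_edist] at hy
  rw [← rw'.coe_dist_eq_edist] at hw
  rw [← rp.coe_dist_eq_edist] at hxp
  rw [← rq.coe_dist_eq_edist] at hxq
  rw [← (reach hyp).coe_dist_eq_edist] at hyp
  rw [← (reach hwq).coe_dist_eq_edist] at hwq
  rw [← ryq.coe_dist_eq_edist, ← rwp.coe_dist_eq_edist]
  norm_cast at *
  have h₁ := hG.four_point (rp.symm.trans rq) rp.symm (rp.symm.trans rx)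
  have h₂ := hG.four_point rwp.symm (rp.symm.trans rq) (rp.symm.trans rx)
  have h₃ := hG.four_point ryq.symm (rq.symm.trans rp) (rq.symm.trans rx)
  simp only [G.dist_comm (u := p), G.dist_comm (u := q) (v := x), G.dist_comm (u := q) (v := y),
    G.dist_comm (u := q) (v := c)] at *
  omega

end SimpleGraph

/-- A laminar family indexed by `I` that separates the points of `X` has at least `#X - 1`
members. -/
lemma Finset.card_le_card_add_one_of_laminar {α ι : Type*} (R : ι → α → Prop) (I : Finset ι)
    (X : Finset α)
    (hlam : ∀ i j, ∀ x ∈ X, ∀ y ∈ X, ∀ w ∈ X, R i x → R j x → R i y → R j w → R j y ∨ R i w)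
    (hsep : ∀ x ∈ X, ∀ y ∈ X, x ≠ y → ∃ i ∈ I, ¬(R i x ↔ R i y)) :
    X.card ≤ I.card + 1 := by
  classical
  induction I using Finset.strongInduction generalizing X with
  | H I ih =>
  by_contra! hcard
  obtain ⟨x, hx, y, hy, hxy⟩ := Finset.one_lt_card.1 (by omega : 1 < X.card)
  obtain ⟨i₀, hi₀, h₀⟩ := hsep x hx y hy hxy
  obtain ⟨i, hi, hmin⟩ := (I.filter fun i => (X.filter (R i)).Nonempty).exists_min_image
    (fun i => (X.filter (R i)).card) <| by
      refine ⟨i₀, Finset.mem_filter.2 ⟨hi₀, ?_⟩⟩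
      by_cases h : R i₀ x
      · exact ⟨x, by simp [hx, h]⟩
      · exact ⟨y, by simp only [Finset.mem_filter]; tauto⟩
  obtain ⟨hiI, a, ha⟩ := Finset.mem_filter.1 hi
  obtain ⟨haX, hia⟩ := Finset.mem_filter.1 ha
  have aux : ∀ j ∈ I, ∀ b ∈ X, ∀ b' ∈ X, R i b → R i b' → R j b → R j b' := by
    intro j hj b hb b' hb' hib hib' hjb
    by_contra hjb'
    have hle := hmin j (Finset.mem_filter.2 ⟨hj, b, by simp [hb, hjb]⟩)
    have hlt : (X.filter (R j)).card < (X.filter (R i)).card := by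
      refine Finset.card_lt_card ⟨fun w hw => ?_, fun hsub => ?_⟩
      · obtain ⟨hwX, hjw⟩ := Finset.mem_filter.1 hw
        exact Finset.mem_filter.2
          ⟨hwX, (hlam i j b hb b' hb' w hwX hib hjb hib' hjw).resolve_left hjb'⟩
      · exact hjb' (Finset.mem_filter.1 (hsub (Finset.mem_filter.2 ⟨hb', hib'⟩))).2
    omega
  have honly : ∀ b ∈ X, R i b → b = a := by
    intro b hb hib
    by_contra hba
    obtain ⟨j, hj, hne⟩ := hsep b hb a haX hba
    exact hne ⟨aux j hj b hb a haX hib hia, aux j hj a haX b hb hia hib⟩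
  have := ih (I.erase i) (Finset.erase_ssubset hiI) (X.erase a)
    (fun k l x hx y hy w hw => hlam k l x (Finset.mem_of_mem_erase hx) y
      (Finset.mem_of_mem_erase hy) w (Finset.mem_of_mem_erase hw)) (fun x hx y hy hxy => by
      rw [Finset.mem_erase] at hx hy
      obtain ⟨j, hj, hne⟩ := hsep x hx.2 y hy.2 hxy
      refine ⟨j, Finset.mem_erase.2 ⟨?_, hj⟩, hne⟩
      rintro rfl
      have := honly x hx.2
      have := honly y hy.2
      tauto)
  rw [Finset.card_erase_of_mem haX, Finset.card_erase_of_mem hiI] at this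
  have := Finset.card_pos.2 ⟨i, hiI⟩
  omega

lemma ENat.exists_natCast_separating {a b : ℕ∞} {k : ℕ}
    (h : min a ((k : ℕ∞) + 1) ≠ min b ((k : ℕ∞) + 1)) :
    ∃ s ≤ k, ¬(a ≤ (s : ℕ∞) ↔ b ≤ (s : ℕ∞)) := by
  wlog hab : a < b generalizing a b
  · have hba : b < a := lt_of_le_of_ne (not_lt.1 hab) (by rintro rfl; exact h rfl)
    obtain ⟨s, hs, hne⟩ := this h.symm hba
    exact ⟨s, hs, fun h' => hne h'.symm⟩
  have hak : a < (k : ℕ∞) + 1 := by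
    by_contra! hka
    exact h (by rw [min_eq_right hka, min_eq_right (hka.trans hab.le)])
  lift a to ℕ using hak.ne_top
  refine ⟨a, ?_, fun h' => absurd (h'.1 le_rfl) (not_le.2 hab)⟩
  norm_cast at hak
  omega

namespace IsResolvingBroadcast

lemma one_const {V : Type*} (G : SimpleGraph V) : IsResolvingBroadcast G fun _ => 1 := by
  intro x y hxy
  refine ⟨x, one_pos, fun h => ?_⟩
  rw [SimpleGraph.edist_self, zero_min, eq_comm, ← bot_eq_zero, min_eq_bot] at h
  rcases h with h | h
  · exact hxy (SimpleGraph.edist_eq_zero_iff.1 h).symm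
  · simp at h

variable {V : Type*} [Fintype V] {G : SimpleGraph V} {f : V → ℕ}

lemma card_sphere_le (hG : G.IsAcyclic) (hf : IsResolvingBroadcast G f) (c : V) (d : ℕ)
    (X : Finset V) (hX : ∀ x ∈ X, G.edist x c = d) : X.card ≤ 2 * ∑ v, f v + 1 := by
  classical
  let I : Finset (Σ _ : V, ℕ) :=
    Finset.univ.sigma fun z => if 0 < f z then Finset.range (f z + 1) else ∅
  have hI : I.card ≤ 2 * ∑ v, f v := by
    rw [Finset.card_sigma, Finset.mul_sum]
    refine Finset.sum_le_sum fun z _ => ?_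
    split_ifs
    · rw [Finset.card_range]; omega
    · simp
  refine (Finset.card_le_card_add_one_of_laminar (fun i x => G.edist x i.1 ≤ (i.2 : ℕ∞)) I X
    ?_ ?_).trans (by omega)
  · intro i j x hx y hy w hw
    exact hG.laminar_of_edist_eq (hX x hx) (hX y hy) (hX w hw)
  · intro x _ y _ hxy
    obtain ⟨z, hz, hne⟩ := hf x y hxy
    obtain ⟨s, hs, hsep⟩ := ENat.exists_natCast_separating hne
    exact ⟨⟨z, s⟩, by simp [I, hz]; omega, hsep⟩

lemma card_ball_le (hG : G.IsAcyclic) (hf : IsResolvingBroadcast G f) (c : V) (k : ℕ)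
    (X : Finset V) (hX : ∀ x ∈ X, G.edist x c ≤ k) : X.card ≤ 1 + k * (2 * ∑ v, f v + 1) := by
  classical
  have hsub : X ⊆ {c} ∪ (Finset.Icc 1 k).biUnion fun d => X.filter fun x => G.edist x c = d := by
    intro x hx
    have hxk := hX x hx
    obtain ⟨d, hd⟩ := ENat.ne_top_iff_exists.1 (ne_top_of_le_ne_top (ENat.natCast_ne_top k) hxk)
    rw [← hd] at hxk
    norm_cast at hxk
    rcases Nat.eq_zero_or_pos d with rfl | hpos
    · have := SimpleGraph.edist_eq_zero_iff.1 hd.symm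
      simp [this]
    · refine Finset.mem_union_right _ (Finset.mem_biUnion.2 ⟨d, ?_, ?_⟩)
      · exact Finset.mem_Icc.2 ⟨hpos, hxk⟩
      · exact Finset.mem_filter.2 ⟨hx, hd.symm⟩
  refine (Finset.card_le_card hsub).trans ((Finset.card_union_le _ _).trans ?_)
  refine Nat.add_le_add (by simp) ?_
  refine (Finset.card_biUnion_le_card_mul _ _ _ fun d _ =>
    hf.card_sphere_le hG c d _ fun x hx => (Finset.mem_filter.1 hx).2).trans (by simp)

lemma card_le_s1 (hG : G.IsAcyclic) (hf : IsResolvingBroadcast G f) :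
    Fintype.card V ≤ 1 + (∑ v, f v) * (2 * ∑ v, f v + 2) := by
  classical
  let B : V → Finset V := fun z =>
    if 0 < f z then Finset.univ.filter fun x => G.edist x z ≤ f z else ∅
  have hB : ∀ z, (B z).card ≤ f z * (2 * ∑ v, f v + 2) := by
    intro z
    simp only [B]
    split_ifs with hz
    · have := hf.card_ball_le hG z (f z) (Finset.univ.filter fun x => G.edist x z ≤ f z)
        fun x hx => (Finset.mem_filter.1 hx).2
      nlinarith
    · simp
  have hunc : (Finset.univ \ Finset.univ.biUnion B).card ≤ 1 := by
    refine Finset.card_le_one.2 fun x hx y hy => ?_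
    by_contra hxy
    obtain ⟨z, hz, hne⟩ := hf x y hxy
    have far : ∀ w ∈ Finset.univ \ Finset.univ.biUnion B, (f z : ℕ∞) + 1 ≤ G.edist w z := by
      intro w hw
      rw [Finset.mem_sdiff] at hw
      refine Order.add_one_le_of_lt (not_le.1 fun hle => hw.2 ?_)
      exact Finset.mem_biUnion.2 ⟨z, Finset.mem_univ z, by simp [B, hz, hle]⟩
    exact hne (by rw [min_eq_right (far x hx), min_eq_right (far y hy)])
  have hcov : (Finset.univ.biUnion B).card ≤ (∑ v, f v) * (2 * ∑ v, f v + 2) := by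
    rw [Finset.sum_mul]
    exact Finset.card_biUnion_le.trans (Finset.sum_le_sum fun z _ => hB z)
  have := Finset.card_sdiff_add_card_eq_card (Finset.subset_univ (Finset.univ.biUnion B))
  rw [Finset.card_univ] at this
  omega

end IsResolvingBroadcast

/-- For every forest (acyclic simple graph) `G` of order `n ≥ 2`,
we have `6 * (bdim G)^2 ≥ n`. -/
theorem bdim_forest_sq_lower_bound {V : Type*} [Fintype V] (G : SimpleGraph V)
    (hG : G.IsAcyclic) (hn : 2 ≤ Fintype.card V) :
    Fintype.card V ≤ 6 * (bdim G) ^ 2 := by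
  obtain ⟨f, hf, hsum⟩ : bdim G ∈ {n : ℕ | ∃ f : V → ℕ, IsResolvingBroadcast G f ∧ ∑ v, f v = n} :=
    Nat.sInf_mem ⟨_, _, IsResolvingBroadcast.one_const G, rfl⟩
  have hcard := hf.card_le_s1 hG
  rw [hsum] at hcard
  rcases Nat.eq_zero_or_pos (bdim G) with h | h
  · simp [h] at hcard
    omega
  · nlinarith
end

section
/- For every forest (acyclic simple graph) G of order n with n ≥ 2, we have 6·(adim(G))² ≥ n; equivalently, adim(G) ≥ √(n/6). -/
open SimpleGraph

/-- `A` is an adjacency resolving set of `G`. -/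
def IsAdjResolvingSet {V : Type*} (G : SimpleGraph V) (A : Set V) : Prop :=
  ∀ x y : V, x ≠ y → ∃ z ∈ A,
    min (G.edist x z) 2 ≠ min (G.edist y z) 2

/-- The adjacency dimension of `G`: the minimum cardinality of an adjacency
resolving set of `G`. -/
noncomputable def adim {V : Type*} [Fintype V] (G : SimpleGraph V) : ℕ :=
  sInf {n : ℕ | ∃ A : Finset V, IsAdjResolvingSet G (A : Set V) ∧ A.card = n}

/-- Two distinct vertices of a forest have at most one common neighbour. -/
theorem SimpleGraph.IsAcyclic.eq_of_common_neighbors {V : Type*} {G : SimpleGraph V}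
    (hG : G.IsAcyclic) {a b x y : V} (hab : a ≠ b) (hxa : G.Adj x a) (hxb : G.Adj x b)
    (hya : G.Adj y a) (hyb : G.Adj y b) : x = y := by
  let p : G.Path a b := ⟨.cons hxa.symm (.cons hxb .nil), by
    simp [Walk.cons_isPath_iff, hab, hxa.ne', hxb.ne]⟩
  let q : G.Path a b := ⟨.cons hya.symm (.cons hyb .nil), by
    simp [Walk.cons_isPath_iff, hab, hya.ne', hyb.ne]⟩
  have h : p.1.support = q.1.support := by rw [(hG.subsingleton_path a b).elim p q]
  simpa [p, q] using h

theorem SimpleGraph.min_edist_two_of_not_adj {V : Type*} {G : SimpleGraph V} {x z : V}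
    (hne : x ≠ z) (hadj : ¬G.Adj x z) : min (G.edist x z) 2 = 2 := by
  have h0 : G.edist x z ≠ 0 := by simpa using hne
  have h1 : G.edist x z ≠ 1 := fun h => hadj (edist_eq_one_iff_adj.mp h)
  refine min_eq_right ?_
  generalize G.edist x z = d at h0 h1
  induction d with
  | top => exact le_top
  | coe m =>
    have h0' : m ≠ 0 := by exact_mod_cast h0
    have h1' : m ≠ 1 := by exact_mod_cast h1
    exact_mod_cast (by omega : 2 ≤ m)

/-- Vertices outside a resolving set are determined by their neighbours in it. -/
theorem IsAdjResolvingSet.eq_of_adj_iff {V : Type*} {G : SimpleGraph V} {A : Set V}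
    (hA : IsAdjResolvingSet G A) {x y : V} (hx : x ∉ A) (hy : y ∉ A)
    (h : ∀ z ∈ A, G.Adj x z ↔ G.Adj y z) : x = y := by
  by_contra hxy
  obtain ⟨z, hz, hne⟩ := hA x y hxy
  have hxz : x ≠ z := fun e => hx (e ▸ hz)
  have hyz : y ≠ z := fun e => hy (e ▸ hz)
  apply hne
  by_cases hadj : G.Adj x z
  · rw [edist_eq_one_iff_adj.mpr hadj, edist_eq_one_iff_adj.mpr ((h z hz).mp hadj)]
  · rw [min_edist_two_of_not_adj hxz hadj,
      min_edist_two_of_not_adj hyz (fun e => hadj ((h z hz).mpr e))]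

/-- The whole vertex set is resolving, so `adim G` is attained. -/
theorem exists_isAdjResolvingSet_card_eq_adim {V : Type*} [Fintype V] (G : SimpleGraph V) :
    ∃ A : Finset V, IsAdjResolvingSet G (A : Set V) ∧ A.card = adim G := by
  refine Nat.sInf_mem
    (s := {n : ℕ | ∃ A : Finset V, IsAdjResolvingSet G (A : Set V) ∧ A.card = n})
    ⟨_, Finset.univ, fun x y hxy => ⟨x, by simp, fun h => hxy ?_⟩, rfl⟩
  rw [edist_self, min_eq_left zero_le, eq_comm, min_eq_iff] at h
  rcases h with h | h
  · exact (edist_eq_zero_iff.mp h.1).symm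
  · simp at h

theorem IsAdjResolvingSet.card_le_of_isAcyclic {V : Type*} [Fintype V] {G : SimpleGraph V}
    {A : Finset V} (hA : IsAdjResolvingSet G (A : Set V)) (hG : G.IsAcyclic) :
    Fintype.card V ≤ A.card + A.card * A.card + 1 := by
  classical
  have hcode : ∀ x : V, ∃ t : Option (A ⊕ A × A), match t with
      | none => x ∉ A ∧ ∀ z ∈ A, ¬G.Adj x z
      | some (.inl a) => x = a
      | some (.inr (a, b)) => x ∉ A ∧ G.Adj x a ∧ G.Adj x b ∧
          (a = b → ∀ z ∈ A, G.Adj x z → z = a) := by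
    intro x
    by_cases hx : x ∈ A
    · exact ⟨some (.inl ⟨x, hx⟩), rfl⟩
    by_cases h0 : ∀ z ∈ A, ¬G.Adj x z
    · exact ⟨none, hx, h0⟩
    push Not at h0
    obtain ⟨a, ha, hxa⟩ := h0
    by_cases h1 : ∀ z ∈ A, G.Adj x z → z = a
    · exact ⟨some (.inr (⟨a, ha⟩, ⟨a, ha⟩)), hx, hxa, hxa, fun _ => h1⟩
    push Not at h1
    obtain ⟨b, hb, hxb, hba⟩ := h1
    exact ⟨some (.inr (⟨a, ha⟩, ⟨b, hb⟩)), hx, hxa, hxb,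
      fun h => absurd (congrArg Subtype.val h).symm hba⟩
  choose f hf using hcode
  have hinj : Function.Injective f := by
    intro x y hxy
    have hx := hf x
    have hy := hf y
    rw [← hxy] at hy
    match h : f x with
    | none =>
      simp only [h] at hx hy
      exact hA.eq_of_adj_iff (by simpa using hx.1) (by simpa using hy.1)
        fun z hz => iff_of_false (hx.2 z hz) (hy.2 z hz)
    | some (.inl a) =>
      simp only [h] at hx hy
      exact hx.trans hy.symm
    | some (.inr (a, b)) =>
      simp only [h] at hx hy
      obtain ⟨hxA, hxa, hxb, hxu⟩ := hx
      obtain ⟨hyA, hya, hyb, hyu⟩ := hy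
      by_cases hab : a = b
      · refine hA.eq_of_adj_iff (by simpa using hxA) (by simpa using hyA) fun z hz => ⟨?_, ?_⟩
        · intro e
          rwa [hxu hab z hz e]
        · intro e
          rwa [hyu hab z hz e]
      · exact hG.eq_of_common_neighbors (fun e => hab (Subtype.ext e)) hxa hxb hya hyb
  simpa using Fintype.card_le_of_injective f hinj

/-- For every forest (acyclic simple graph) `G` of order `n ≥ 2`,
we have `6 * (adim G)^2 ≥ n`. -/
theorem adim_forest_sq_lower_bound {V : Type*} [Fintype V] (G : SimpleGraph V)
    (hG : G.IsAcyclic) (hn : 2 ≤ Fintype.card V) :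
    Fintype.card V ≤ 6 * (adim G) ^ 2 := by
  obtain ⟨A, hA, hcard⟩ := exists_isAdjResolvingSet_card_eq_adim G
  have hle := hA.card_le_of_isAcyclic hG
  rw [hcard] at hle
  have hpos : 1 ≤ adim G := by
    by_contra h
    have h0 : adim G = 0 := by omega
    rw [h0] at hle
    omega
  nlinarith
end

section
/- For every positive integer k, there exists a tree T with exactly (k+1)(k+2)/2 vertices such that bdim(T) ≤ 4k. -/
open SimpleGraph

namespace SimpleGraph

variable {V W : Type*} {G : SimpleGraph V} {H : SimpleGraph W}

/-- A function that changes by at most one along edges, vanishes at `z`, and decreases along some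
edge at every vertex other than `z` is the distance to `z`. -/
theorem edist_eq_of_descending (z : V) (φ : V → ℕ) (h0 : φ z = 0)
    (hlip : ∀ x y, G.Adj x y → φ x ≤ φ y + 1)
    (hdesc : ∀ x, x ≠ z → ∃ y, G.Adj x y ∧ φ x = φ y + 1) (x : V) :
    G.edist x z = φ x := by
  apply le_antisymm
  · suffices ∀ n x, φ x = n → ∃ p : G.Walk x z, p.length = n by
      obtain ⟨p, hp⟩ := this _ x rfl
      exact hp ▸ edist_le p
    intro n
    induction n with
    | zero =>
      intro x hx
      by_cases hxz : x = z
      · subst hxz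
        exact ⟨.nil, rfl⟩
      · obtain ⟨y, -, hy⟩ := hdesc x hxz
        omega
    | succ n ih =>
      intro x hx
      obtain ⟨y, hadj, hy⟩ := hdesc x (by rintro rfl; omega)
      obtain ⟨p, hp⟩ := ih y (by omega)
      exact ⟨.cons hadj p, by simp [hp]⟩
  · have hwalk : ∀ (u v : V) (p : G.Walk u v), φ u ≤ φ v + p.length := by
      intro u v p
      induction p with
      | nil => simp
      | cons hadj p ih =>
        have := hlip _ _ hadj
        rw [Walk.length_cons]
        omega
    rw [edist_eq_sInf]
    refine le_sInf ?_
    rintro _ ⟨p, rfl⟩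
    have := hwalk x z p
    rw [h0, zero_add] at this
    exact Nat.cast_le.2 this

/-- A graph whose vertices are ranked so that adjacent vertices have consecutive ranks, and every
vertex other than the root `z` has exactly one neighbour of smaller rank, is a tree. -/
theorem isTree_of_rank [Finite V] (z : V) (φ : V → ℕ) (h0 : φ z = 0)
    (hadj : ∀ x y, G.Adj x y → φ x = φ y + 1 ∨ φ y = φ x + 1)
    (hdesc : ∀ x, x ≠ z → ∃ y, G.Adj x y ∧ φ x = φ y + 1)
    (huniq : ∀ x y y', G.Adj x y → G.Adj x y' → φ x = φ y + 1 → φ x = φ y' + 1 → y = y') :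
    G.IsTree := by
  classical
  have hdist := edist_eq_of_descending z φ h0 (fun x y h => by have := hadj x y h; omega) hdesc
  have hreach (x : V) : G.Reachable x z := reachable_of_edist_ne_top (by simp [hdist])
  have hconn : G.Connected :=
    { preconnected := fun x y => (hreach x).trans (hreach y).symm
      nonempty := ⟨z⟩ }
  refine isTree_iff_connected_and_card.2
    ⟨hconn, le_antisymm ?_ hconn.card_vert_le_card_edgeSet_add_one⟩
  choose! p hp hφ using hdesc
  have hsub : G.edgeSet ⊆ (fun x => s(x, p x)) '' {z}ᶜ := by
    intro e
    induction e with
    | _ x y =>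
      intro he
      rw [mem_edgeSet] at he
      rcases hadj x y he with h | h
      · have hx : x ≠ z := by rintro rfl; omega
        exact ⟨x, hx, by simp [huniq x y (p x) he (hp x hx) h (hφ x hx)]⟩
      · have hy : y ≠ z := by rintro rfl; omega
        exact ⟨y, hy, by simp [huniq y x (p y) he.symm (hp y hy) h (hφ y hy), Sym2.eq_swap]⟩
  have hle : G.edgeSet.ncard ≤ ({z}ᶜ : Set V).ncard :=
    (Set.ncard_le_ncard hsub).trans (Set.ncard_image_le (Set.toFinite _))
  have hcompl := Set.ncard_add_ncard_compl ({z} : Set V)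
  rw [Set.ncard_singleton] at hcompl
  rw [Nat.card_coe_set_eq]
  omega

theorem Iso.edist_eq (e : G ≃g H) (x y : V) : H.edist (e x) (e y) = G.edist x y := by
  refine le_antisymm ?_ ?_
  · refine le_sInf ?_
    rintro _ ⟨p, rfl⟩
    simpa using edist_le (p.map e.toHom)
  · refine le_sInf ?_
    rintro _ ⟨p, rfl⟩
    simpa using edist_le ((p.map e.symm.toHom).copy (e.symm_apply_apply x) (e.symm_apply_apply y))

end SimpleGraph

section Broadcast

variable {V W : Type*} {G : SimpleGraph V} {H : SimpleGraph W}

theorem IsResolvingBroadcast.comp_iso {f : W → ℕ} (hf : IsResolvingBroadcast H f) (e : G ≃g H) :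
    IsResolvingBroadcast G (f ∘ e) := by
  intro x y hxy
  obtain ⟨z, hz, hne⟩ := hf (e x) (e y) (e.injective.ne hxy)
  obtain ⟨z, rfl⟩ := e.surjective z
  rw [e.edist_eq, e.edist_eq] at hne
  exact ⟨z, hz, hne⟩

variable [Fintype V] [Fintype W]

theorem IsResolvingBroadcast.bdim_le {f : V → ℕ} (hf : IsResolvingBroadcast G f) :
    bdim G ≤ ∑ v, f v :=
  Nat.sInf_le ⟨f, hf, rfl⟩

/-- Two vertices `a` and `b` whose distance functions are bounded by `r` and jointly injective give
a resolving broadcast of cost `2 * r`. -/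
theorem exists_isResolvingBroadcast_of_pair {a b : V} {φ ψ : V → ℕ} {r : ℕ} (hr : 0 < r)
    (hφ : ∀ x, G.edist x a = φ x) (hψ : ∀ x, G.edist x b = ψ x)
    (hφr : ∀ x, φ x ≤ r) (hψr : ∀ x, ψ x ≤ r)
    (hinj : ∀ x y, φ x = φ y → ψ x = ψ y → x = y) :
    ∃ f : V → ℕ, IsResolvingBroadcast G f ∧ ∑ v, f v = 2 * r := by
  classical
  refine ⟨Pi.single a r + Pi.single b r, ?_, ?_⟩
  · have hmin {n m : ℕ} (h : n ≤ r) (hm : r ≤ m) : min (n : ℕ∞) ((m : ℕ∞) + 1) = n :=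
      min_eq_left (by exact_mod_cast (h.trans hm).trans m.le_succ)
    have ha : r ≤ (Pi.single a r + Pi.single b r : V → ℕ) a := by simp
    have hb : r ≤ (Pi.single a r + Pi.single b r : V → ℕ) b := by simp
    intro x y hxy
    by_cases h : φ x = φ y
    · refine ⟨b, hr.trans_le hb, ?_⟩
      rw [hψ, hψ, hmin (hψr x) hb, hmin (hψr y) hb]
      exact_mod_cast fun h' => hxy (hinj x y h h')
    · refine ⟨a, hr.trans_le ha, ?_⟩
      rw [hφ, hφ, hmin (hφr x) ha, hmin (hφr y) ha]
      exact_mod_cast h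
  · simp [Finset.sum_add_distrib, two_mul]

end Broadcast

/-- The vertices of the comb with spine `0, …, k` and a leg with `i` vertices at the spine vertex
`i`: the pair `⟨i, j⟩` is the vertex at height `j` above the spine vertex `i`. -/
abbrev CombVertex (k : ℕ) : Type := Σ i : Fin (k + 1), Fin (i + 1)

namespace CombVertex

variable {k : ℕ}

theorem card : Fintype.card (CombVertex k) = (k + 1) * (k + 2) / 2 := by
  have h := Finset.sum_range_id (k + 2)
  rw [Finset.sum_range_succ'] at h
  simp only [Fintype.card_sigma, Fintype.card_fin]
  rw [Fin.sum_univ_eq_sum_range (fun i => i + 1)]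
  rw [mul_comm]
  simpa using h

theorem ext_coords {x y : CombVertex k} (h₁ : (x.1 : ℕ) = y.1) (h₂ : (x.2 : ℕ) = y.2) :
    x = y := by
  obtain ⟨i, j⟩ := x
  obtain ⟨i', j'⟩ := y
  obtain rfl : i = i' := Fin.ext h₁
  obtain rfl : j = j' := Fin.ext h₂
  rfl

end CombVertex

/-- The comb with spine `0, …, k` and a leg with `i` vertices at the spine vertex `i`. -/
def comb (k : ℕ) : SimpleGraph (CombVertex k) where
  Adj x y :=
    ((x.1 : ℕ) = y.1 ∧ ((x.2 : ℕ) = y.2 + 1 ∨ (y.2 : ℕ) = x.2 + 1)) ∨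
    ((x.2 : ℕ) = 0 ∧ (y.2 : ℕ) = 0 ∧ ((x.1 : ℕ) = y.1 + 1 ∨ (y.1 : ℕ) = x.1 + 1))
  symm := ⟨fun _ _ _ => by omega⟩
  loopless := ⟨fun _ _ => by omega⟩

namespace comb

variable {k : ℕ}

theorem adj_iff {x y : CombVertex k} : (comb k).Adj x y ↔
    ((x.1 : ℕ) = y.1 ∧ ((x.2 : ℕ) = y.2 + 1 ∨ (y.2 : ℕ) = x.2 + 1)) ∨
    ((x.2 : ℕ) = 0 ∧ (y.2 : ℕ) = 0 ∧ ((x.1 : ℕ) = y.1 + 1 ∨ (y.1 : ℕ) = x.1 + 1)) :=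
  Iff.rfl

theorem exists_adj_down (x : CombVertex k) (hx : (x.2 : ℕ) ≠ 0) :
    ∃ y, (comb k).Adj x y ∧ (y.1 : ℕ) = x.1 ∧ (x.2 : ℕ) = y.2 + 1 :=
  ⟨⟨x.1, x.2 - 1, by omega⟩, Or.inl ⟨rfl, Or.inl (by simp only; omega)⟩, rfl, by simp only; omega⟩

theorem exists_adj_left (x : CombVertex k) (hx : (x.2 : ℕ) = 0) (hx' : (x.1 : ℕ) ≠ 0) :
    ∃ y, (comb k).Adj x y ∧ (x.1 : ℕ) = y.1 + 1 ∧ (y.2 : ℕ) = 0 :=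
  ⟨⟨⟨x.1 - 1, by omega⟩, 0⟩, Or.inr ⟨hx, rfl, Or.inl (by simp only; omega)⟩,
    by simp only; omega, rfl⟩

theorem exists_adj_right (x : CombVertex k) (hx : (x.2 : ℕ) = 0) (hx' : (x.1 : ℕ) ≠ k) :
    ∃ y, (comb k).Adj x y ∧ (y.1 : ℕ) = x.1 + 1 ∧ (y.2 : ℕ) = 0 :=
  ⟨⟨⟨x.1 + 1, by omega⟩, 0⟩, Or.inr ⟨hx, rfl, Or.inr rfl⟩, rfl, rfl⟩

theorem exists_adj_toward_left (x : CombVertex k) (hx : x ≠ ⟨0, 0⟩) :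
    ∃ y, (comb k).Adj x y ∧ (x.1 + x.2 : ℕ) = (y.1 + y.2 : ℕ) + 1 := by
  by_cases h₂ : (x.2 : ℕ) = 0
  · obtain ⟨y, hy, h, h'⟩ := exists_adj_left x h₂ fun h₁ => hx (CombVertex.ext_coords h₁ h₂)
    exact ⟨y, hy, by omega⟩
  · obtain ⟨y, hy, h, h'⟩ := exists_adj_down x h₂
    exact ⟨y, hy, by omega⟩

theorem exists_adj_toward_right (x : CombVertex k) (hx : x ≠ ⟨Fin.last k, 0⟩) :
    ∃ y, (comb k).Adj x y ∧ (k - x.1 + x.2 : ℕ) = (k - y.1 + y.2 : ℕ) + 1 := by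
  by_cases h₂ : (x.2 : ℕ) = 0
  · obtain ⟨y, hy, h, h'⟩ := exists_adj_right x h₂ fun h₁ => hx (CombVertex.ext_coords h₁ h₂)
    exact ⟨y, hy, by omega⟩
  · obtain ⟨y, hy, h, h'⟩ := exists_adj_down x h₂
    exact ⟨y, hy, by omega⟩

theorem edist_left (x : CombVertex k) : (comb k).edist x ⟨0, 0⟩ = (x.1 + x.2 : ℕ) :=
  edist_eq_of_descending _ (fun x : CombVertex k => (x.1 + x.2 : ℕ)) rfl
    (fun x y h => by rw [adj_iff] at h; omega) exists_adj_toward_left x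

theorem edist_right (x : CombVertex k) :
    (comb k).edist x ⟨Fin.last k, 0⟩ = (k - x.1 + x.2 : ℕ) :=
  edist_eq_of_descending _ (fun x : CombVertex k => (k - x.1 + x.2 : ℕ)) (by simp)
    (fun x y h => by rw [adj_iff] at h; omega) exists_adj_toward_right x

theorem isTree : (comb k).IsTree := by
  refine isTree_of_rank ⟨0, 0⟩ (fun x : CombVertex k => (x.1 + x.2 : ℕ)) rfl ?_
    exists_adj_toward_left ?_
  · intro x y h
    rw [adj_iff] at h
    omega
  · intro x y y' h h' hy hy'
    rw [adj_iff] at h h'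
    exact CombVertex.ext_coords (by omega) (by omega)

theorem exists_isResolvingBroadcast (hk : 0 < k) :
    ∃ f : CombVertex k → ℕ, IsResolvingBroadcast (comb k) f ∧ ∑ v, f v = 2 * (2 * k) :=
  exists_isResolvingBroadcast_of_pair (by omega) edist_left edist_right
    (fun x => by omega) (fun x => by omega)
    fun x y h h' => CombVertex.ext_coords (by omega) (by omega)

end comb

/-- For every positive integer `k`, there exists a tree with exactly
`(k+1)(k+2)/2` vertices whose broadcast dimension is at most `4k`. -/
theorem exists_tree_card_bdim_le {k : ℕ} (hk : 0 < k) :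
    ∃ G : SimpleGraph (Fin ((k + 1) * (k + 2) / 2)), G.IsTree ∧ bdim G ≤ 4 * k := by
  let e := (comb k).overFinIso CombVertex.card
  refine ⟨_, e.isTree_iff.1 comb.isTree, ?_⟩
  obtain ⟨f, hf, hsum⟩ := comb.exists_isResolvingBroadcast hk
  refine (hf.comp_iso e.symm).bdim_le.trans_eq ?_
  rw [show ∑ v, (f ∘ e.symm) v = ∑ v, f v from Equiv.sum_comp e.symm.toEquiv f, hsum]
  ring
end

section
/- If T₂ is a tree and T₁ is a tree that is isomorphic to a subgraph of T₂, then bdim(T₁) ≤ bdim(T₂). -/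
open SimpleGraph

/-- In an acyclic graph every path is a shortest walk. -/
lemma SimpleGraph.IsAcyclic.edist_eq_length {V : Type*} {G : SimpleGraph V} (hG : G.IsAcyclic)
    {u v : V} {p : G.Walk u v} (hp : p.IsPath) : G.edist u v = p.length := by
  obtain ⟨q, hq, hlen⟩ := p.reachable.exists_path_of_dist
  have h : p = q := 
    congrArg Subtype.val ((hG.subsingleton_path u v).elim ⟨p, hp⟩ ⟨q, hq⟩)
  rw [← p.reachable.coe_dist_eq_edist, ← hlen, h]

/-- A vertex of an acyclic graph reaches a connected subgraph through a single gate: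
its distances to the subgraph are the distances to the gate plus a constant. -/
lemma SimpleGraph.IsAcyclic.exists_gate_s6 {V W : Type*} {G : SimpleGraph V} {H : SimpleGraph W}
    (hH : H.IsAcyclic) (hG : G.Connected) (f : G →g H) (hf : Function.Injective f) (z : W)
    (hz : ∃ a, H.Reachable (f a) z) :
    ∃ (p : V) (k : ℕ), ∀ x, H.edist (f x) z = G.edist x p + k := by
  obtain ⟨a, ha⟩ := hz
  have hreach (x : V) : H.Reachable (f x) z := ((hG x a).map f).trans ha
  obtain ⟨p, hp⟩ : ∃ p, ∀ b, H.dist (f p) z ≤ H.dist (f b) z :=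
    have : Nonempty V := ⟨a⟩
    ⟨_, fun b => Function.argmin_le (fun x => H.dist (f x) z) b⟩
  obtain ⟨q, hq, hqlen⟩ := (hreach p).exists_path_of_dist
  refine ⟨p, q.length, fun x => ?_⟩
  obtain ⟨r, hr, hrlen⟩ := hG.exists_path_of_dist x p
  have hpath : ((r.map f).append q).IsPath := by
    classical
    rw [Walk.isPath_def, Walk.support_append, List.nodup_append']
    refine ⟨(hr.map hf).support_nodup, hq.support_nodup.tail, fun w hw hwq => ?_⟩
    rw [Walk.support_map, List.mem_map] at hw
    obtain ⟨b, -, rfl⟩ := hw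
    have hne : f b ≠ f p := by
      have hnd := hq.support_nodup
      rw [← Walk.cons_tail_support, List.nodup_cons] at hnd
      exact fun h => hnd.1 (by rwa [h] at hwq)
    have hmem := List.mem_of_mem_tail hwq
    have hlt := Walk.length_dropUntil_lt_length hmem hne
    have hle := dist_le (q.dropUntil (f b) hmem)
    have hmin := hp b
    omega
  rw [hH.edist_eq_length hpath, Walk.length_append, Walk.length_map, hrlen,
    ← (hG x p).coe_dist_eq_edist]
  push_cast
  rfl

lemma min_ne_min_of_min_add_ne {a b k m n : ℕ∞} (hmn : m ≤ n)
    (h : min (a + k) m ≠ min (b + k) m) : min a n ≠ min b n := by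
  contrapose! h
  obtain rfl | hab := eq_or_ne a b
  · rfl
  obtain ⟨ha, hb⟩ : n ≤ a ∧ n ≤ b := by
    grind
  rw [min_eq_right (hmn.trans (ha.trans le_self_add)),
    min_eq_right (hmn.trans (hb.trans le_self_add))]

/-- Pushing a resolving broadcast forward along a gate map gives a resolving broadcast. -/
lemma IsResolvingBroadcast.push {V W : Type*} [Fintype W] [DecidableEq V]
    {G : SimpleGraph V} {H : SimpleGraph W} {f : W → ℕ} (hf : IsResolvingBroadcast H f)
    (φ : V ↪ W) (g : W → V) (k : W → ℕ)
    (hg : ∀ z x, H.edist (φ x) z = G.edist x (g z) + k z) :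
    IsResolvingBroadcast G fun p => ∑ z with g z = p, f z := by
  intro x y hxy
  obtain ⟨z, hz, hne⟩ := hf (φ x) (φ y) (φ.injective.ne hxy)
  have hle : f z ≤ ∑ w with g w = g z, f w :=
    Finset.single_le_sum (fun _ _ => Nat.zero_le _) (by simp)
  refine ⟨g z, hz.trans_le hle, ?_⟩
  rw [hg, hg] at hne
  exact min_ne_min_of_min_add_ne (by gcongr) hne

/-- If `T₂` is a tree and `T₁` is a tree isomorphic to a subgraph of `T₂`,
then `bdim T₁ ≤ bdim T₂`. -/
theorem bdim_mono_of_tree_subgraph {V₁ V₂ : Type*} [Fintype V₁] [Fintype V₂]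
    (T₁ : SimpleGraph V₁) (T₂ : SimpleGraph V₂)
    (h₁ : T₁.IsTree) (h₂ : T₂.IsTree)
    (φ : V₁ ↪ V₂) (hφ : ∀ a b : V₁, T₁.Adj a b → T₂.Adj (φ a) (φ b)) :
    bdim T₁ ≤ bdim T₂ := by
  classical
  have hmem : bdim T₂ ∈ {n : ℕ | ∃ f : V₂ → ℕ, IsResolvingBroadcast T₂ f ∧ ∑ v, f v = n} :=
    Nat.sInf_mem ⟨_, _, isResolvingBroadcast_one T₂, rfl⟩
  obtain ⟨f, hf, hsum⟩ := hmem
  obtain ⟨a⟩ := h₁.connected.nonempty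
  choose g k hg using fun z => h₂.isAcyclic.exists_gate_s6 h₁.connected
    (⟨φ, fun {a b} h => hφ a b h⟩ : T₁ →g T₂) φ.injective z ⟨a, h₂.connected _ z⟩
  exact Nat.sInf_le ⟨_, hf.push φ g k hg, by rw [← hsum]; exact Finset.sum_fiberwise _ g f⟩
end

section
/- For every positive integer k, there exists a finite simple graph G such that bdim(G) ≤ 2k + 3 and adim(G) ≥ 2^k. Consequently, there is a family of graphs {G_k} with bdim(G_k) = Θ(k) and adim(G_k) = 2^{Ω(k)}. -/
open SimpleGraph

namespace SimpleGraph

variable {V : Type*} {G : SimpleGraph V}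

lemma eq_or_adj_or_exists_adj_adj_of_edist_le_two {u v : V} (h : G.edist u v ≤ 2) :
    u = v ∨ G.Adj u v ∨ ∃ w, G.Adj u w ∧ G.Adj w v := by
  have hne : G.edist u v ≠ ⊤ := ne_top_of_le_ne_top (by decide) h
  obtain ⟨p, hp⟩ := exists_walk_of_edist_ne_top hne
  rw [← hp] at h
  have hlen : p.length ≤ 2 := by exact_mod_cast h
  match p, hlen with
  | .nil, _ => exact Or.inl rfl
  | .cons h₁ .nil, _ => exact Or.inr (Or.inl h₁)
  | .cons h₁ (.cons h₂ .nil), _ => exact Or.inr (Or.inr ⟨_, h₁, h₂⟩)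
  | .cons _ (.cons _ (.cons _ q)), h' => simp at h'

lemma min_edist_two_eq {x y z : V} (hx : x ≠ z) (hy : y ≠ z) (h : G.Adj x z ↔ G.Adj y z) :
    min (G.edist x z) 2 = min (G.edist y z) 2 := by
  have two_le : ∀ u : V, u ≠ z → ¬ G.Adj u z → 2 ≤ G.edist u z := fun u hu ha => by
    have h₀ : 0 < G.edist u z := G.edist_pos_of_ne hu
    have h₁ : G.edist u z ≠ 1 := fun h => ha (edist_eq_one_iff_adj.1 h)
    have h₂ := lt_of_le_of_ne (Order.one_le_iff_pos.2 h₀) h₁.symm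
    have := Order.add_one_le_of_lt h₂
    rwa [one_add_one_eq_two] at this
  by_cases ha : G.Adj x z
  · rw [edist_eq_one_iff_adj.2 ha, edist_eq_one_iff_adj.2 (h.1 ha)]
  · rw [min_eq_right (two_le x hx ha), min_eq_right (two_le y hy (mt h.2 ha))]

end SimpleGraph

lemma ENat.min_add_one_ne {a b n : ℕ∞} (hn : n ≠ ⊤) (ha : a ≤ n) (hab : a ≠ b) :
    min a (n + 1) ≠ min b (n + 1) := by
  have han : a < n + 1 := lt_of_le_of_lt ha (ENat.lt_add_one_iff hn |>.2 le_rfl)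
  rw [min_eq_left han.le]
  intro h
  rcases min_choice b (n + 1) with hb | hb
  · exact hab (h.trans hb)
  · exact han.ne (h.trans hb)

/-- Vertices of the gadget graph: a hub `inl none`, coding vertices `inl (some i)`, and for every
`S` a middle vertex `inr (0, S)` and a pair `inr (1, S)`, `inr (2, S)`. -/
abbrev GadgetVertex (k : ℕ) : Type := Option (Fin k) ⊕ (Fin 3 × Finset (Fin k))

/-- The hub is joined to all middle vertices, the coding vertex of `i` to all vertices with label
`S ∋ i`, and the middle vertex of each `S` to the first vertex of its pair. -/
def gadgetRel (k : ℕ) : GadgetVertex k → GadgetVertex k → Prop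
  | .inl none, .inr (a, _) => a = 0
  | .inl (some i), .inr (_, S) => i ∈ S
  | .inr (a, S), .inr (b, T) => S = T ∧ a = 0 ∧ b = 1
  | _, .inl _ => False

/-- The gadget graph, whose broadcast dimension is small and adjacency dimension is large. -/
def gadgetGraph (k : ℕ) : SimpleGraph (GadgetVertex k) := SimpleGraph.fromRel (gadgetRel k)

/-- The broadcast of strength 2 at the hub and strength 1 at each coding vertex. -/
def gadgetBroadcast (k : ℕ) : GadgetVertex k → ℕ
  | .inl none => 2
  | .inl (some _) => 1
  | .inr _ => 0

section Gadget

variable {k : ℕ}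

lemma gadgetGraph_adj_hub_iff {a : Fin 3} {S : Finset (Fin k)} :
    (gadgetGraph k).Adj (.inr (a, S)) (.inl none) ↔ a = 0 := by
  simp [gadgetGraph, gadgetRel]

lemma gadgetGraph_adj_code_iff {a : Fin 3} {S : Finset (Fin k)} {i : Fin k} :
    (gadgetGraph k).Adj (.inr (a, S)) (.inl (some i)) ↔ i ∈ S := by
  simp [gadgetGraph, gadgetRel]

lemma edist_pair_fst_hub_le (S : Finset (Fin k)) :
    (gadgetGraph k).edist (.inr (1, S)) (.inl none) ≤ 2 := by
  have h₁ : (gadgetGraph k).Adj (.inr (1, S)) (.inr (0, S)) := by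
    simp [gadgetGraph, gadgetRel]
  calc _ ≤ (gadgetGraph k).edist (.inr (1, S)) (.inr (0, S)) +
        (gadgetGraph k).edist (.inr (0, S)) (.inl none) := (gadgetGraph k).edist_triangle
    _ = 2 := by
      rw [edist_eq_one_iff_adj.2 h₁, edist_eq_one_iff_adj.2 (gadgetGraph_adj_hub_iff.2 rfl),
        one_add_one_eq_two]

lemma not_edist_pair_snd_hub_le (S : Finset (Fin k)) :
    ¬ (gadgetGraph k).edist (.inr (2, S)) (.inl none) ≤ 2 := by
  intro h
  rcases eq_or_adj_or_exists_adj_adj_of_edist_le_two h with h | h | ⟨w, h₁, h₂⟩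
  · simp at h
  · simp [gadgetGraph_adj_hub_iff] at h
  · rcases w with (_ | i) | ⟨a, T⟩
    · simp at h₂
    · simp [gadgetGraph, gadgetRel] at h₂
    · rw [gadgetGraph_adj_hub_iff] at h₂
      subst h₂
      simp [gadgetGraph, gadgetRel] at h₁

lemma isResolvingBroadcast_gadgetBroadcast :
    IsResolvingBroadcast (gadgetGraph k) (gadgetBroadcast k) := by
  have key : ∀ x y : GadgetVertex k,
      (∃ z, 0 < gadgetBroadcast k z ∧ (gadgetGraph k).edist x z ≤ gadgetBroadcast k z ∧
        (gadgetGraph k).edist x z ≠ (gadgetGraph k).edist y z) →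
      ∃ z, 0 < gadgetBroadcast k z ∧
        min ((gadgetGraph k).edist x z) ((gadgetBroadcast k z : ℕ∞) + 1) ≠
          min ((gadgetGraph k).edist y z) ((gadgetBroadcast k z : ℕ∞) + 1) :=
    fun x y ⟨z, hz, hle, hne⟩ => ⟨z, hz, ENat.min_add_one_ne (ENat.natCast_ne_top _) hle hne⟩
  have self : ∀ (z : Option (Fin k)) (y : GadgetVertex k), .inl z ≠ y →
      ∃ z', 0 < gadgetBroadcast k z' ∧
        min ((gadgetGraph k).edist (.inl z) z') ((gadgetBroadcast k z' : ℕ∞) + 1) ≠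
          min ((gadgetGraph k).edist y z') ((gadgetBroadcast k z' : ℕ∞) + 1) := by
    intro z y hy
    refine key _ _ ⟨.inl z, by cases z <;> simp [gadgetBroadcast], by simp, ?_⟩
    rw [SimpleGraph.edist_self]
    exact ((gadgetGraph k).edist_pos_of_ne hy.symm).ne
  have code : ∀ (a b : Fin 3) (S T : Finset (Fin k)) (i : Fin k), i ∈ S → i ∉ T →
      ∃ z, 0 < gadgetBroadcast k z ∧
        min ((gadgetGraph k).edist (.inr (a, S)) z) ((gadgetBroadcast k z : ℕ∞) + 1) ≠
          min ((gadgetGraph k).edist (.inr (b, T)) z) ((gadgetBroadcast k z : ℕ∞) + 1) := by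
    intro a b S T i hS hT
    have hd := edist_eq_one_iff_adj.2 (gadgetGraph_adj_code_iff (a := a).2 hS)
    refine key _ _ ⟨.inl (some i), by simp [gadgetBroadcast], by simp [hd, gadgetBroadcast], ?_⟩
    rw [hd]
    exact fun h => hT (gadgetGraph_adj_code_iff.1 (edist_eq_one_iff_adj.1 h.symm))
  have level : ∀ (a b : Fin 3) (S : Finset (Fin k)), a < b →
      ∃ z, 0 < gadgetBroadcast k z ∧
        min ((gadgetGraph k).edist (.inr (a, S)) z) ((gadgetBroadcast k z : ℕ∞) + 1) ≠
          min ((gadgetGraph k).edist (.inr (b, S)) z) ((gadgetBroadcast k z : ℕ∞) + 1) := by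
    intro a b S hab
    refine key _ _ ⟨.inl none, by simp [gadgetBroadcast], ?_⟩
    by_cases ha : a = 0
    · have hd := edist_eq_one_iff_adj.2 (gadgetGraph_adj_hub_iff (S := S).2 ha)
      rw [hd]
      refine ⟨by simp [gadgetBroadcast], fun h => ?_⟩
      have := gadgetGraph_adj_hub_iff.1 (edist_eq_one_iff_adj.1 h.symm)
      omega
    · obtain rfl : a = 1 := by omega
      obtain rfl : b = 2 := by omega
      exact ⟨edist_pair_fst_hub_le S,
        fun h => not_edist_pair_snd_hub_le S (h ▸ edist_pair_fst_hub_le S)⟩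
  rintro (x | ⟨a, S⟩) (y | ⟨b, T⟩) hxy
  · exact self x _ hxy
  · exact self x _ hxy
  · simpa only [ne_comm] using self y _ hxy.symm
  · by_cases hST : S = T
    · subst hST
      rcases lt_trichotomy a b with h | rfl | h
      · exact level a b S h
      · exact absurd rfl hxy
      · simpa only [ne_comm] using level b a S h
    · obtain ⟨i, hi⟩ : ∃ i, ¬ (i ∈ S ↔ i ∈ T) := by
        by_contra! h
        exact hST (Finset.ext h)
      by_cases hS : i ∈ S
      · exact code a b S T i hS (by tauto)
      · simpa only [ne_comm] using code b a T S i (by tauto) hS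

lemma bdim_gadgetGraph_le : bdim (gadgetGraph k) ≤ k + 2 := by
  refine Nat.sInf_le ⟨gadgetBroadcast k, isResolvingBroadcast_gadgetBroadcast, ?_⟩
  simp [Fintype.sum_sum_type, Fintype.sum_option, gadgetBroadcast, add_comm]

lemma IsAdjResolvingSet.exists_label_mem {A : Set (GadgetVertex k)}
    (hA : IsAdjResolvingSet (gadgetGraph k) A) (S : Finset (Fin k)) : ∃ a, .inr (a, S) ∈ A := by
  obtain ⟨z, hz, hne⟩ := hA (.inr (1, S)) (.inr (2, S)) (by simp)
  by_contra! h
  refine hne (min_edist_two_eq ?_ ?_ ?_)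
  · rintro rfl
    exact h 1 hz
  · rintro rfl
    exact h 2 hz
  · rcases z with (_ | i) | ⟨a, T⟩
    · simp [gadgetGraph_adj_hub_iff]
    · simp [gadgetGraph_adj_code_iff]
    · have hTS : T ≠ S := by
        rintro rfl
        exact h a hz
      simp [gadgetGraph, gadgetRel, hTS, hTS.symm]

lemma isAdjResolvingSet_univ {V : Type*} (G : SimpleGraph V) : IsAdjResolvingSet G Set.univ := by
  intro x y hxy
  refine ⟨x, Set.mem_univ x, ?_⟩
  have h : 0 < min (G.edist y x) 2 := lt_min (G.edist_pos_of_ne hxy.symm) (by decide)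
  simpa using h.ne

lemma two_pow_le_adim_gadgetGraph : 2 ^ k ≤ adim (gadgetGraph k) := by
  refine le_csInf ⟨_, Finset.univ, by simpa using isAdjResolvingSet_univ _, rfl⟩ ?_
  rintro _ ⟨A, hA, rfl⟩
  choose a ha using hA.exists_label_mem
  have h := Finset.card_le_card_of_injOn (s := Finset.univ) (t := A)
    (fun S => (.inr (a S, S) : GadgetVertex k)) (fun S _ => ha S)
    (fun S _ T _ h => (Prod.ext_iff.1 (Sum.inr_injective h)).2)
  simpa using h

end Gadget

/-- For every positive integer `k` there is a finite graph `G` with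
`bdim G ≤ 2k + 3` and `adim G ≥ 2^k`. -/
theorem exists_graph_bdim_small_adim_large (k : ℕ) (hk : 0 < k) :
    ∃ (V : Type) (inst : Fintype V) (G : SimpleGraph V),
      @bdim V inst G ≤ 2 * k + 3 ∧ 2 ^ k ≤ @adim V inst G :=
  ⟨GadgetVertex k, inferInstance, gadgetGraph k,
    bdim_gadgetGraph_le.trans (by omega), two_pow_le_adim_gadgetGraph⟩
end

section
/- Let G be a connected finite simple graph with at least two vertices, let e = uv ∈ E(G) be an edge such that the graph G − e obtained by deleting e is connected, and let f be a resolving broadcast of G. Let b = max_{w ∈ V(G)} f(w), and define f' : V(G) → ℕ by f'(u) = f'(v) = b and f'(w) = f(w) for all w ∉ {u, v}. Then f' is a resolving broadcast of G − e. -/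
open SimpleGraph

theorem isResolvingBroadcast_iff_dist {V : Type*} {G : SimpleGraph V} (hG : G.Connected)
    {f : V → ℕ} :
    IsResolvingBroadcast G f ↔ ∀ x y : V, x ≠ y → ∃ z : V, 0 < f z ∧
      min (G.dist x z) (f z + 1) ≠ min (G.dist y z) (f z + 1) := by
  have h (x y z : V) :
      min (G.edist x z) ((f z : ℕ∞) + 1) ≠ min (G.edist y z) ((f z : ℕ∞) + 1) ↔
        min (G.dist x z) (f z + 1) ≠ min (G.dist y z) (f z + 1) := by
    rw [← (hG x z).coe_dist_eq_edist, ← (hG y z).coe_dist_eq_edist]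
    rw [← Nat.cast_one, ← Nat.cast_add, ← Nat.mono_cast.map_min, ← Nat.mono_cast.map_min]
    exact Nat.cast_injective.ne_iff
  simp only [IsResolvingBroadcast, h]

/-- A walk in `G` from `x` to `z` is at least as long as a shortest path in `G - uv`, or as a
shortest route that crosses the edge `uv` exactly once. -/
theorem dist_deleteEdges_le_length {V : Type*} {G : SimpleGraph V} {u v : V}
    (hGe : (G.deleteEdges {s(u, v)}).Connected) {x z : V} (p : G.Walk x z) :
    (G.deleteEdges {s(u, v)}).dist x z ≤ p.length ∨
      (G.deleteEdges {s(u, v)}).dist x u + 1 + (G.deleteEdges {s(u, v)}).dist v z ≤ p.length ∨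
      (G.deleteEdges {s(u, v)}).dist x v + 1 + (G.deleteEdges {s(u, v)}).dist u z ≤ p.length := by
  induction p with
  | nil => simp
  | @cons x w z hxw p ih =>
    rw [Walk.length_cons]
    by_cases he : s(x, w) = s(u, v)
    · have hu := (G.deleteEdges {s(u, v)}).dist_self (v := u)
      have hv := (G.deleteEdges {s(u, v)}).dist_self (v := v)
      rcases Sym2.eq_iff.mp he with ⟨rfl, rfl⟩ | ⟨rfl, rfl⟩ <;> omega
    · have hadj : (G.deleteEdges {s(u, v)}).Adj x w := by
        simp [deleteEdges_adj, hxw, he]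
      have hone := dist_eq_one_iff_adj.mpr hadj
      have hz := hGe.dist_triangle (u := x) (v := w) (w := z)
      have hu := hGe.dist_triangle (u := x) (v := w) (w := u)
      have hv := hGe.dist_triangle (u := x) (v := w) (w := v)
      omega

/-- If `z` resolves `x, y` in `G` with range `r`, then `x, y` are resolved in `G - uv` by `z`
with the same range, or by `u` or `v` with range smaller than `r`. -/
theorem exists_dist_deleteEdges_lt {V : Type*} {G : SimpleGraph V} {u v : V}
    (huv : G.Adj u v) (hG : G.Connected) (hGe : (G.deleteEdges {s(u, v)}).Connected)
    {x y z : V} {r : ℕ} (hlt : G.dist x z < G.dist y z) (hr : G.dist x z ≤ r) :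
    ((G.deleteEdges {s(u, v)}).dist x z ≤ r ∧
      (G.deleteEdges {s(u, v)}).dist x z < (G.deleteEdges {s(u, v)}).dist y z) ∨
    ∃ w, (w = u ∨ w = v) ∧ (G.deleteEdges {s(u, v)}).dist x w < r ∧
      (G.deleteEdges {s(u, v)}).dist x w < (G.deleteEdges {s(u, v)}).dist y w := by
  have hmono (a c : V) : G.dist a c ≤ (G.deleteEdges {s(u, v)}).dist a c :=
    (hGe a c).dist_anti (deleteEdges_le _)
  obtain ⟨p, hp⟩ := hG.exists_walk_length_eq_dist x z
  have hyz := hmono y z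
  have huz := hmono u z
  have hvz := hmono v z
  have hyu := hmono y u
  have hyv := hmono y v
  have huv_one := dist_eq_one_iff_adj.mpr huv
  have hvu_one := dist_eq_one_iff_adj.mpr huv.symm
  have tu := hG.dist_triangle (u := y) (v := u) (w := z)
  have tv := hG.dist_triangle (u := y) (v := v) (w := z)
  have tuv := hG.dist_triangle (u := u) (v := v) (w := z)
  have tvu := hG.dist_triangle (u := v) (v := u) (w := z)
  rcases dist_deleteEdges_le_length hGe p with h | h | h
  · left; omega
  · exact .inr ⟨u, .inl rfl, by omega, by omega⟩
  · exact .inr ⟨v, .inr rfl, by omega, by omega⟩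

/-- If `f` is a resolving broadcast of a connected graph `G` with at least two vertices,
`e = uv` is an edge with `G - e` connected, and `b` is the maximum value of `f`, then
the function obtained from `f` by setting the values at `u` and `v` to `b` is a
resolving broadcast of `G - e`. -/
theorem update_isResolvingBroadcast_deleteEdge {V : Type*} [Fintype V] [DecidableEq V]
    (G : SimpleGraph V) (hn : 2 ≤ Fintype.card V)
    (u v : V) (huv : G.Adj u v) (hG : G.Connected)
    (hGe : (G.deleteEdges {s(u, v)}).Connected)
    (f : V → ℕ) (hf : IsResolvingBroadcast G f) :
    IsResolvingBroadcast (G.deleteEdges {s(u, v)})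
      (fun w => if w = u ∨ w = v then Finset.univ.sup f else f w) := by
  rw [isResolvingBroadcast_iff_dist hGe]
  rw [isResolvingBroadcast_iff_dist hG] at hf
  have hsup (w : V) : f w ≤ Finset.univ.sup f := Finset.le_sup (Finset.mem_univ w)
  intro x y hxy
  obtain ⟨z, hz, hne⟩ := hf x y hxy
  wlog hlt : G.dist x z < G.dist y z generalizing x y
  · obtain ⟨w, hw, hwne⟩ := this y x hxy.symm hne.symm (by omega)
    exact ⟨w, hw, hwne.symm⟩
  have hzb := hsup z
  rcases exists_dist_deleteEdges_lt huv hG hGe hlt (r := f z) (by omega) with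
    ⟨hr, h⟩ | ⟨w, hw, hr, h⟩
  · refine ⟨z, ?_, ?_⟩ <;> split_ifs <;> omega
  · refine ⟨w, ?_, ?_⟩ <;> simp only [hw, if_true] <;> omega
end
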